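/- arXiv:1612.00094 — 7 statements merged into one kernel-verified Lean document; each statement's English description precedes it below -/
import Mathlib

section
/- Let W be a finite nonempty linearly ordered set, let Π be a nonempty finite index set, and let (p^π)_{π∈Π} be a family of probability mass functions on W. Fix τ ∈ (0,1]. Define F^π(w) = Σ_{w' ≤ w} p^π(w'), G_≺^π(w) = Σ_{w' > w} p^π(w') = 1 − F^π(w), the lower τ-quantile q̲_τ^π = min{w ∈ W : F^π(w) ≥ τ}, the optimal lower τ-quantile q̲* = max_{π∈Π} q̲_τ^π, and G_≺*(w) = max_{π∈Π} G_≺^π(w). Then q̲* = min{w ∈ W : G_≺*(w) ≤ 1 − τ}. -/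
/-- Lemma 1 rewritten: the optimal lower τ-quantile satisfies
`q̲* = min {w : G_≺*(w) ≤ 1 − τ}` where `G_≺*(w) = max_π G_≺^π(w)` and
`G_≺^π(w) = Σ_{w' > w} p^π(w') = 1 − F^π(w)`. -/
theorem stmt1 {W ι : Type*} [Fintype W] [LinearOrder W] [Nonempty W]
    [Fintype ι] [Nonempty ι]
    (p : ι → W → ℝ)
    (hp_nonneg : ∀ π w, 0 ≤ p π w)
    (hp_sum : ∀ π, ∑ w, p π w = 1)
    (τ : ℝ) (hτ : τ ∈ Set.Ioc (0 : ℝ) 1)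
    (F : ι → W → ℝ)
    (hF : ∀ π w, F π w = ∑ w' ∈ Finset.univ.filter (fun w' => w' ≤ w), p π w')
    (Gs : ι → W → ℝ)
    (hGs : ∀ π w, Gs π w = ∑ w' ∈ Finset.univ.filter (fun w' => w < w'), p π w')
    (hGsF : ∀ π w, Gs π w = 1 - F π w)
    (q : ι → W) (hq : ∀ π, IsLeast {w | τ ≤ F π w} (q π))
    (qstar : W) (hqstar : IsGreatest (Set.range q) qstar)
    (Gsstar : W → ℝ)
    (hGsstar : ∀ w, IsGreatest (Set.range fun π => Gs π w) (Gsstar w)) :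
    IsLeast {w | Gsstar w ≤ 1 - τ} qstar := by
  have hF_mono : ∀ π, Monotone (F π) := by
    intro π a b hab
    rw [hF, hF]
    refine Finset.sum_le_sum_of_subset_of_nonneg ?_ fun w _ _ => hp_nonneg π w
    intro w hw
    simp only [Finset.mem_filter, Finset.mem_univ, true_and] at hw ⊢
    exact hw.trans hab
  constructor
  · obtain ⟨π, hπ⟩ := (hGsstar qstar).1
    have hπ' : Gs π qstar = Gsstar qstar := hπ
    have hτF : τ ≤ F π (q π) := (hq π).1
    have hFq : F π (q π) ≤ F π qstar := hF_mono π (hqstar.2 ⟨π, rfl⟩)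
    change Gsstar qstar ≤ 1 - τ
    linarith [hGsF π qstar]
  · intro w hw
    have hw' : Gsstar w ≤ 1 - τ := hw
    obtain ⟨π, rfl⟩ := hqstar.1
    have hGs_le : Gs π w ≤ Gsstar w := (hGsstar w).2 ⟨π, rfl⟩
    refine (hq π).2 ?_
    change τ ≤ F π w
    linarith [hGsF π w]
end

section
/- Let W be a finite nonempty linearly ordered set, let Π be a nonempty finite index set, let (p^π)_{π∈Π} be a family of probability mass functions on W, and fix τ ∈ (0,1]. Define F^π(w) = Σ_{w' ≤ w} p^π(w'), q̲_τ^π = min{w ∈ W : F^π(w) ≥ τ}, q̲* = max_{π∈Π} q̲_τ^π, F*(w) = min_{π∈Π} F^π(w), and prec(w) = max{w' ∈ W : w' < w} if this set is nonempty and prec(w) = w otherwise. Then every π* ∈ Π satisfying F^{π*}(prec(q̲*)) = F*(prec(q̲*)) satisfies q̲_τ^{π*} = q̲*, i.e., it is optimal for the lower τ-quantile criterion. -/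
/-- Any policy `π*` with `F^{π*}(prec(q̲*)) = F*(prec(q̲*))` is optimal for the
lower τ-quantile criterion, i.e. `q̲_τ^{π*} = q̲*`. -/
theorem stmt3 {W ι : Type*} [Fintype W] [LinearOrder W] [Nonempty W]
    [Fintype ι] [Nonempty ι]
    (p : ι → W → ℝ)
    (hp_nonneg : ∀ π w, 0 ≤ p π w)
    (hp_sum : ∀ π, ∑ w, p π w = 1)
    (τ : ℝ) (hτ : τ ∈ Set.Ioc (0 : ℝ) 1)
    (F : ι → W → ℝ)
    (hF : ∀ π w, F π w = ∑ w' ∈ Finset.univ.filter (fun w' => w' ≤ w), p π w')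
    (q : ι → W) (hq : ∀ π, IsLeast {w | τ ≤ F π w} (q π))
    (qstar : W) (hqstar : IsGreatest (Set.range q) qstar)
    (Fstar : W → ℝ)
    (hFstar : ∀ w, IsLeast (Set.range fun π => F π w) (Fstar w))
    (prec : W → W)
    (hprec₁ : ∀ w : W, {w' | w' < w}.Nonempty → IsGreatest {w' | w' < w} (prec w))
    (hprec₂ : ∀ w : W, ¬ {w' | w' < w}.Nonempty → prec w = w) :
    ∀ πstar : ι, F πstar (prec qstar) = Fstar (prec qstar) → q πstar = qstar := by
  intro πstar h_eq
  obtain ⟨π₀, rfl⟩ := hqstar.1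
  refine (hqstar.2 ⟨πstar, rfl⟩).eq_of_not_lt fun h_lt => ?_
  obtain ⟨h_prec_lt, h_le_prec⟩ := hprec₁ (q π₀) ⟨q πstar, h_lt⟩
  have h_mono : F πstar (q πstar) ≤ F πstar (prec (q π₀)) := by
    rw [hF, hF]
    refine Finset.sum_le_sum_of_subset_of_nonneg ?_ fun w _ _ => hp_nonneg πstar w
    exact Finset.monotone_filter_right _ fun w _ hw => hw.trans (h_le_prec h_lt)
  have h_min : Fstar (prec (q π₀)) ≤ F π₀ (prec (q π₀)) := (hFstar _).2 ⟨π₀, rfl⟩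
  have h_τ : τ ≤ F π₀ (prec (q π₀)) :=
    (hq πstar).1.trans (h_mono.trans (h_eq.le.trans h_min))
  exact ((hq π₀).2 h_τ).not_gt h_prec_lt
end

section
/- Let W be a finite nonempty linearly ordered set, let Π be a nonempty finite index set, let (p^π)_{π∈Π} be a family of probability mass functions on W, and fix τ ∈ [0,1). Define G^π(w) = Σ_{w' ≥ w} p^π(w'), q̄_τ^π = max{w ∈ W : G^π(w) ≥ 1 − τ}, and q̄* = max_{π∈Π} q̄_τ^π. Then every π* ∈ Π satisfying G^{π*}(q̄*) = max_{π∈Π} G^π(q̄*) satisfies q̄_τ^{π*} = q̄*, i.e., it is optimal for the upper τ-quantile criterion. -/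
/-- Any policy `π*` with `G^{π*}(q̄*) = max_π G^π(q̄*)` is optimal for the
upper τ-quantile criterion, i.e. `q̄_τ^{π*} = q̄*`. -/
theorem stmt4 {W ι : Type*} [Fintype W] [LinearOrder W] [Nonempty W]
    [Fintype ι] [Nonempty ι]
    (p : ι → W → ℝ)
    (hp_nonneg : ∀ π w, 0 ≤ p π w)
    (hp_sum : ∀ π, ∑ w, p π w = 1)
    (τ : ℝ) (hτ : τ ∈ Set.Ico (0 : ℝ) 1)
    (G : ι → W → ℝ)
    (hG : ∀ π w, G π w = ∑ w' ∈ Finset.univ.filter (fun w' => w ≤ w'), p π w')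
    (q : ι → W) (hq : ∀ π, IsGreatest {w | 1 - τ ≤ G π w} (q π))
    (qstar : W) (hqstar : IsGreatest (Set.range q) qstar) :
    ∀ πstar : ι, IsGreatest (Set.range fun π => G π qstar) (G πstar qstar) →
      q πstar = qstar := by
  intro πstar hmax
  obtain ⟨π₀, hπ₀⟩ := hqstar.1
  have h₀ : 1 - τ ≤ G π₀ qstar := hπ₀ ▸ (hq π₀).1
  exact le_antisymm (hqstar.2 ⟨πstar, rfl⟩)
    ((hq πstar).2 (h₀.trans (hmax.2 ⟨π₀, rfl⟩)))
end

section
/- Let W be a finite nonempty subset of ℝ, let Π be a nonempty finite index set, let (p^π)_{π∈Π} be a family of probability mass functions on W, fix τ ∈ [0,1) and ε > 0. Define G^π(w) = Σ_{w' ≥ w} p^π(w'), q̄_τ^π = max{w ∈ W : G^π(w) ≥ 1 − τ}, and q̄* = max_{π∈Π} q̄_τ^π. If π ∈ Π and w ∈ ℝ satisfy |w − q̄*| ≤ ε and G^π(w) ≥ 1 − τ (where G^π is extended to ℝ by G^π(x) = Σ_{w' ∈ W, w' ≥ x} p^π(w')), then |q̄_τ^π − q̄*| ≤ ε, i.e.,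 π is ε-optimal for the upper τ-quantile criterion. -/
/-- A tail sum over a finite set that is nonzero at `x` takes the same value at some point of the
set lying weakly above `x`. -/
theorem exists_mem_ge_tail_sum_eq (W : Finset ℝ) (f : ℝ → ℝ) (x : ℝ)
    (hx : ∑ w ∈ W.filter (fun w => x ≤ w), f w ≠ 0) :
    ∃ m ∈ W, x ≤ m ∧
      ∑ w ∈ W.filter (fun w => m ≤ w), f w = ∑ w ∈ W.filter (fun w => x ≤ w), f w := by
  have hne : (W.filter (fun w => x ≤ w)).Nonempty := Finset.nonempty_of_sum_ne_zero hx
  obtain ⟨m, hm, hmin⟩ := Finset.exists_min_image _ id hne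
  obtain ⟨hmW, hxm⟩ := Finset.mem_filter.mp hm
  refine ⟨m, hmW, hxm, congrArg (fun s => ∑ w ∈ s, f w) (Finset.filter_congr fun w hw => ?_)⟩
  exact ⟨hxm.trans, fun h => hmin w (Finset.mem_filter.mpr ⟨hw, h⟩)⟩

/-- ε-optimality sufficient condition (upper quantile): if `|w − q̄*| ≤ ε` and
`G^π(w) ≥ 1 − τ` then `π` is ε-optimal for the upper τ-quantile criterion. -/
theorem stmt6 {ι : Type*} [Fintype ι] [Nonempty ι]
    (W : Finset ℝ) (hW : W.Nonempty)
    (p : ι → ℝ → ℝ)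
    (hp_nonneg : ∀ π, ∀ w ∈ W, 0 ≤ p π w)
    (hp_sum : ∀ π, ∑ w ∈ W, p π w = 1)
    (τ : ℝ) (hτ : τ ∈ Set.Ico (0 : ℝ) 1)
    (ε : ℝ) (hε : 0 < ε)
    (G : ι → ℝ → ℝ)
    (hG : ∀ π (x : ℝ), G π x = ∑ w' ∈ W.filter (fun w' => x ≤ w'), p π w')
    (q : ι → ℝ) (hq : ∀ π, IsGreatest {w | w ∈ W ∧ 1 - τ ≤ G π w} (q π))
    (qstar : ℝ) (hqstar : IsGreatest (Set.range q) qstar) :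
    ∀ (π : ι) (w : ℝ), |w - qstar| ≤ ε → 1 - τ ≤ G π w → |q π - qstar| ≤ ε := by
  intro π w hw hGw
  have hne : ∑ w' ∈ W.filter (fun w' => w ≤ w'), p π w' ≠ 0 := by
    rw [← hG]
    linarith [hτ.2]
  obtain ⟨m, hmW, hwm, hm⟩ := exists_mem_ge_tail_sum_eq W (p π) w hne
  have hmq : m ≤ q π := (hq π).2 ⟨hmW, by rwa [hG, hm, ← hG]⟩
  have hqle : q π ≤ qstar := hqstar.2 ⟨π, rfl⟩
  rw [abs_le] at hw ⊢
  constructor <;> linarith [hw.1]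
end

section
/- Consider a finite-horizon Markov decision process with finite state space S, finite nonempty action space A, transition function P : S × A → PMF(S), reward function r : S × A → ℝ, initial state s₀ ∈ S, and horizon T ≥ 1. A (randomized history-dependent) policy π assigns to each partial history (s₀, a₀, s₁, …, s_t) with t < T a probability distribution over A; it induces a probability distribution over T-histories h_T = (s₀, a₀, …, a_{T−1}, s_T) by sampling each a_t from π applied to the current partial history and each s_{t+1} from P(s_t, a_t). The wealth of a history is w(h_T) = Σ_{t=0}^{T−1} r(s_t, a_t). For τ ∈ (0,1], the lower τ-quantile of π is q̲_τ^π = min{x ∈ ℝ : x is a wealth value of some T-history and P_π[w(H_T) ≤ x] ≥ τ}. Then there exists a deterministic wealth-Markovian policy — i.e., a policy given by maps δ_t : S × ℝ → A for t = 1, …, T that select an action as a function only of the time step, the current state, and the sum of rewards accumulated so far — whose lower τ-quantile equals max over all randomized history-dependent policies π of q̲_τ^π. -/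
namespace Stmt12

/-- A `T`-history: a sequence of `T` actions together with the `T + 1` visited
states (`h.2 0` is the initial state). -/
abbrev Hist (S A : Type) (T : ℕ) := (Fin T → A) × (Fin (T + 1) → S)

/-- A randomized history-dependent policy: to each time step `t < T` and each
partial history `(s₀, a₀, s₁, …, s_t)` (given by the `t` actions and `t + 1`
states so far) it assigns a function `A → ℝ` (intended: a probability
distribution over actions). -/
abbrev Policy (S A : Type) (T : ℕ) :=
  (t : Fin T) → (Fin t → A) → (Fin (t + 1) → S) → A → ℝ

/-- The condition that `π` indeed assigns probability distributions over
actions. -/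
def IsPolicy {S A : Type} [Fintype A] {T : ℕ} (π : Policy S A T) : Prop :=
  (∀ t as ss a, 0 ≤ π t as ss a) ∧ (∀ t as ss, ∑ a, π t as ss a = 1)

/-- Probability that policy `π` generates the `T`-history `h` in the MDP with
transition function `P` and initial state `s0`: each action is sampled from `π`
applied to the current partial history and each next state from `P`. -/
def histProb {S A : Type} [DecidableEq S] {T : ℕ}
    (P : S → A → S → ℝ) (s0 : S) (π : Policy S A T) (h : Hist S A T) : ℝ :=
  (if h.2 0 = s0 then (1 : ℝ) else 0) *
    ∏ t : Fin T,
      π t (fun i => h.1 (Fin.castLE t.isLt.le i))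
          (fun i => h.2 (Fin.castLE (Nat.succ_le_succ t.isLt.le) i))
          (h.1 t) *
        P (h.2 t.castSucc) (h.1 t) (h.2 t.succ)

/-- The wealth of a `T`-history: the sum of the rewards received along it. -/
def wealth {S A : Type} {T : ℕ} (r : S → A → ℝ) (h : Hist S A T) : ℝ :=
  ∑ t : Fin T, r (h.2 t.castSucc) (h.1 t)

/-- `P_π[w(H_T) ≤ x]`: probability under policy `π` that the wealth of the
generated `T`-history is at most `x`. -/
noncomputable def cdf {S A : Type} [Fintype S] [Fintype A] [DecidableEq S] {T : ℕ}
    (P : S → A → S → ℝ) (s0 : S) (r : S → A → ℝ) (π : Policy S A T) (x : ℝ) : ℝ :=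
  ∑ h : Hist S A T, if wealth r h ≤ x then histProb P s0 π h else 0

/-- The (deterministic) policy induced by a deterministic wealth-Markovian
decision rule `δ`: at time `t`, in current state `s` with accumulated wealth
`w`, play action `δ t s w` with probability one. -/
def wmPolicy {S A : Type} [DecidableEq A] {T : ℕ} (r : S → A → ℝ)
    (δ : Fin T → S → ℝ → A) : Policy S A T :=
  fun t as ss a =>
    if a = δ t (ss (Fin.last t)) (∑ i : Fin t, r (ss i.castSucc) (as i)) then 1
    else 0

/-- Restriction of a policy to the first `T` of its `T + 1` time steps. -/
def Policy.truncate {S A : Type} {T : ℕ} (π : Policy S A (T + 1)) : Policy S A T :=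
  fun t => π t.castSucc

/-- Extend a history by one action and one state. -/
def Hist.snoc {S A : Type} {T : ℕ} (h : Hist S A T) (a : A) (s : S) : Hist S A (T + 1) :=
  (Fin.snoc (α := fun _ => A) h.1 a, Fin.snoc (α := fun _ => S) h.2 s)

/-- A history of length `T + 1` is a history of length `T` with one more action and state. -/
def Hist.snocEquiv (S A : Type) (T : ℕ) : Hist S A T × A × S ≃ Hist S A (T + 1) where
  toFun p := p.1.snoc p.2.1 p.2.2
  invFun h := ((fun i => h.1 i.castSucc, fun i => h.2 i.castSucc),
    h.1 (Fin.last T), h.2 (Fin.last (T + 1)))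
  left_inv p := by simp [Hist.snoc]
  right_inv h := by
    refine Prod.ext ?_ ?_
    · exact Fin.snoc_init_self (α := fun _ => A) h.1
    · exact Fin.snoc_init_self (α := fun _ => S) h.2

theorem Hist.snoc_last {S A : Type} {T : ℕ} (h : Hist S A T) (a : A) (s : S) :
    (h.snoc a s).2 (Fin.last (T + 1)) = s := by
  simp [Hist.snoc]

theorem wealth_snoc {S A : Type} {T : ℕ} (r : S → A → ℝ) (h : Hist S A T) (a : A) (s : S) :
    wealth r (h.snoc a s) = wealth r h + r (h.2 (Fin.last T)) a := by
  simp [wealth, Hist.snoc, Fin.sum_univ_castSucc]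

theorem histProb_snoc {S A : Type} [DecidableEq S] {T : ℕ} (P : S → A → S → ℝ) (s0 : S)
    (π : Policy S A (T + 1)) (h : Hist S A T) (a : A) (s : S) :
    histProb P s0 π (h.snoc a s) =
      histProb P s0 π.truncate h *
        (π (Fin.last T) h.1 h.2 a * P (h.2 (Fin.last T)) a s) := by
  have e1 : ∀ i : Fin T, (h.snoc a s).1 i.castSucc = h.1 i := fun i =>
    Fin.snoc_castSucc (α := fun _ => A) a h.1 i
  have e2 : ∀ i : Fin (T + 1), (h.snoc a s).2 i.castSucc = h.2 i := fun i =>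
    Fin.snoc_castSucc (α := fun _ => S) s h.2 i
  have e3 : (h.snoc a s).1 (Fin.last T) = a := Fin.snoc_last (α := fun _ => A) a h.1
  have e0 : (h.snoc a s).2 0 = h.2 0 := e2 0
  have hlast : π (Fin.last T)
      (fun i => (h.snoc a s).1 (Fin.castLE (Fin.last T).isLt.le i))
      (fun i => (h.snoc a s).2 (Fin.castLE (Nat.succ_le_succ (Fin.last T).isLt.le) i)) =
      π (Fin.last T) h.1 h.2 :=
    congrArg₂ (π (Fin.last T)) (funext fun i => e1 i) (funext fun i => e2 i)
  have hinit : ∀ t : Fin T, π t.castSucc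
      (fun i => (h.snoc a s).1 (Fin.castLE t.castSucc.isLt.le i))
      (fun i => (h.snoc a s).2 (Fin.castLE (Nat.succ_le_succ t.castSucc.isLt.le) i)) =
      π.truncate t (fun i => h.1 (Fin.castLE t.isLt.le i))
        (fun i => h.2 (Fin.castLE (Nat.succ_le_succ t.isLt.le) i)) := fun t =>
    congrArg₂ (π t.castSucc) (funext fun i => e1 (Fin.castLE t.isLt.le i))
      (funext fun i => e2 (Fin.castLE (Nat.succ_le_succ t.isLt.le) i))
  unfold histProb
  rw [Fin.prod_univ_castSucc, hlast, e0, e2, e3, Fin.succ_last, Hist.snoc_last, ← mul_assoc]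
  congr 2
  refine Finset.prod_congr rfl fun t _ => ?_
  rw [hinit, e1, e2, Fin.succ_castSucc, e2]

theorem IsPolicy.truncate {S A : Type} [Fintype A] {T : ℕ} {π : Policy S A (T + 1)} (hπ : IsPolicy π) :
    IsPolicy π.truncate :=
  ⟨fun t => hπ.1 t.castSucc, fun t => hπ.2 t.castSucc⟩

theorem histProb_nonneg {S A : Type} [DecidableEq S] [Fintype A] {P : S → A → S → ℝ}
    {s0 : S} {T : ℕ} (hP : ∀ s a s', 0 ≤ P s a s') {π : Policy S A T} (hπ : IsPolicy π) (h : Hist S A T) : 0 ≤ histProb P s0 π h := by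
  refine mul_nonneg (by split_ifs <;> norm_num) ?_
  exact Finset.prod_nonneg fun t _ => mul_nonneg (hπ.1 _ _ _ _) (hP _ _ _)

theorem isPolicy_wmPolicy {S A : Type} [Fintype A] {r : S → A → ℝ} {T : ℕ}
    [DecidableEq A] (δ : Fin T → S → ℝ → A) :
    IsPolicy (wmPolicy r δ) := by
  refine ⟨fun t as ss a => ?_, fun t as ss => ?_⟩
  · unfold wmPolicy
    split_ifs <;> norm_num
  · simp [wmPolicy]

/-- Expectation of a terminal cost depending on the final state and the wealth. -/
noncomputable def expCost {S A : Type} [Fintype S] [Fintype A] [DecidableEq S] {T : ℕ}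
    (P : S → A → S → ℝ) (s0 : S) (r : S → A → ℝ) (π : Policy S A T) (f : S → ℝ → ℝ) : ℝ :=
  ∑ h : Hist S A T, histProb P s0 π h * f (h.2 (Fin.last T)) (wealth r h)

/-- Expected cost after playing `a` once in state `s` with wealth `w`. -/
noncomputable def stepCost {S A : Type} [Fintype S] (P : S → A → S → ℝ) (r : S → A → ℝ)
    (f : S → ℝ → ℝ) (s : S) (w : ℝ) (a : A) : ℝ :=
  ∑ s', P s a s' * f s' (w + r s a)

section

variable {S A : Type} [Fintype S] [DecidableEq S] [Fintype A]
  {P : S → A → S → ℝ} {r : S → A → ℝ} {s0 : S} {T : ℕ}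

theorem expCost_succ (π : Policy S A (T + 1)) (f : S → ℝ → ℝ) :
    expCost P s0 r π f = ∑ h : Hist S A T, histProb P s0 π.truncate h *
      ∑ a, π (Fin.last T) h.1 h.2 a * stepCost P r f (h.2 (Fin.last T)) (wealth r h) a := by
  unfold expCost
  rw [← (Hist.snocEquiv S A T).sum_comp, Fintype.sum_prod_type]
  refine Finset.sum_congr rfl fun h _ => ?_
  rw [Fintype.sum_prod_type, Finset.mul_sum]
  refine Finset.sum_congr rfl fun a _ => ?_
  rw [stepCost, Finset.mul_sum, Finset.mul_sum]
  refine Finset.sum_congr rfl fun s _ => ?_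
  change histProb P s0 π (h.snoc a s) *
    f ((h.snoc a s).2 (Fin.last (T + 1))) (wealth r (h.snoc a s)) = _
  rw [histProb_snoc, Hist.snoc_last, wealth_snoc]
  ring

theorem expCost_zero (π : Policy S A 0) (f : S → ℝ → ℝ) :
    expCost P s0 r π f = f s0 0 := by
  unfold expCost
  rw [Fintype.sum_prod_type, Fintype.sum_unique, ← (Equiv.funUnique (Fin 1) S).symm.sum_comp]
  simp [histProb, wealth]

theorem expCost_one (hP_sum : ∀ s a, ∑ s', P s a s' = 1) {π : Policy S A T}
    (hπ : IsPolicy π) : expCost P s0 r π (fun _ _ => 1) = 1 := by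
  induction T with
  | zero => exact expCost_zero π _
  | succ T ih =>
    rw [expCost_succ]
    simp only [stepCost, mul_one, hP_sum]
    refine Eq.trans ?_ (ih hπ.truncate)
    refine Finset.sum_congr rfl fun h _ => ?_
    exact congrArg (histProb P s0 π.truncate h * ·) (hπ.2 (Fin.last T) h.1 h.2)

/-- Backward induction: some deterministic wealth-Markovian policy minimizes the expectation of
any given terminal cost among all policies. -/
theorem exists_wmPolicy_expCost_le [DecidableEq A] [Nonempty A]
    (hP : ∀ s a s', 0 ≤ P s a s') (f : S → ℝ → ℝ) :
    ∃ δ : Fin T → S → ℝ → A, ∀ π : Policy S A T, IsPolicy π →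
      expCost P s0 r (wmPolicy r δ) f ≤ expCost P s0 r π f := by
  induction T generalizing f with
  | zero =>
    exact ⟨fun t => t.elim0, fun π _ => by rw [expCost_zero, expCost_zero]⟩
  | succ T ih =>
    choose α hα using fun s w => Finite.exists_min (stepCost P r f s w)
    obtain ⟨δ, hδ⟩ := ih fun s w => stepCost P r f s w (α s w)
    refine ⟨Fin.snoc (α := fun _ => S → ℝ → A) δ α, fun π hπ => ?_⟩
    have htrunc : (wmPolicy r (Fin.snoc (α := fun _ => S → ℝ → A) δ α)).truncate =
        wmPolicy r δ := by
      funext t as ss a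
      simp only [Policy.truncate, wmPolicy, Fin.snoc_castSucc]
      rfl
    calc expCost P s0 r (wmPolicy r (Fin.snoc (α := fun _ => S → ℝ → A) δ α)) f
        = expCost P s0 r (wmPolicy r δ) (fun s w => stepCost P r f s w (α s w)) := by
          rw [expCost_succ, htrunc]
          refine Finset.sum_congr rfl fun h _ => congrArg _ ?_
          simp only [wmPolicy, Fin.snoc_last, ite_mul, one_mul, zero_mul]
          exact Finset.sum_ite_eq' _ _ _ |>.trans (if_pos (Finset.mem_univ _))
      _ ≤ expCost P s0 r π.truncate (fun s w => stepCost P r f s w (α s w)) :=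
          hδ _ hπ.truncate
      _ ≤ expCost P s0 r π f := by
          rw [expCost_succ]
          refine Finset.sum_le_sum fun h _ =>
            mul_le_mul_of_nonneg_left ?_ (histProb_nonneg hP hπ.truncate h)
          calc stepCost P r f (h.2 (Fin.last T)) (wealth r h)
                (α (h.2 (Fin.last T)) (wealth r h))
              = ∑ a, π (Fin.last T) h.1 h.2 a * stepCost P r f (h.2 (Fin.last T)) (wealth r h)
                  (α (h.2 (Fin.last T)) (wealth r h)) := by
                rw [← Finset.sum_mul]
                exact ((congrArg (· * _) (hπ.2 (Fin.last T) h.1 h.2)).trans (one_mul _)).symm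
            _ ≤ _ := Finset.sum_le_sum fun a _ =>
                mul_le_mul_of_nonneg_left (hα _ _ a) (hπ.1 (Fin.last T) h.1 h.2 a)

/-- The probability that the wealth stays strictly below `x`. -/
noncomputable def strictCdf (P : S → A → S → ℝ) (s0 : S) (r : S → A → ℝ)
    (π : Policy S A T) (x : ℝ) : ℝ :=
  expCost P s0 r π fun _ w => if w < x then 1 else 0

theorem cdf_le_strictCdf (hP : ∀ s a s', 0 ≤ P s a s') {π : Policy S A T}
    (hπ : IsPolicy π) {x y : ℝ} (hyx : y < x) :
    cdf P s0 r π y ≤ strictCdf P s0 r π x := by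
  refine Finset.sum_le_sum fun h _ => ?_
  have := histProb_nonneg (s0 := s0) hP hπ h
  by_cases h1 : wealth r h ≤ y
  · simp [h1, h1.trans_lt hyx]
  · simp only [h1, if_false]
    split_ifs <;> simp [this]

/-- Strictly below the lower `τ`-quantile there is less than `τ` of the mass. -/
theorem strictCdf_lt_of_isLeast {τ : ℝ} (hτ : 0 < τ) {π : Policy S A T} {q : ℝ}
    (hq : IsLeast {x | (∃ h : Hist S A T, wealth r h = x) ∧ τ ≤ cdf P s0 r π x} q) :
    strictCdf P s0 r π q < τ := by
  by_cases hne : ∃ h : Hist S A T, wealth r h < q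
  · obtain ⟨h₀, hh₀, hmax⟩ := Set.exists_max_image {h : Hist S A T | wealth r h < q}
      (wealth r) (Set.toFinite _) hne
    have heq : strictCdf P s0 r π q = cdf P s0 r π (wealth r h₀) := by
      refine Finset.sum_congr rfl fun h _ => ?_
      by_cases h1 : wealth r h < q
      · simp [h1, hmax h h1]
      · have h2 : ¬ wealth r h ≤ wealth r h₀ := fun h3 => h1 (h3.trans_lt hh₀)
        simp [h1, h2]
    rw [heq]
    by_contra! hcon
    exact (hq.2 ⟨⟨h₀, rfl⟩, hcon⟩).not_gt hh₀
  · push Not at hne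
    have heq : strictCdf P s0 r π q = 0 :=
      Finset.sum_eq_zero fun h _ => by simp [(hne h).not_gt]
    rwa [heq]

/-- Every policy has a lower `τ`-quantile. -/
theorem exists_isLeast_quantile [Nonempty S] [Nonempty A]
    (hP_sum : ∀ s a, ∑ s', P s a s' = 1) {τ : ℝ} (hτ : τ ≤ 1) {π : Policy S A T}
    (hπ : IsPolicy π) :
    ∃ q, IsLeast {x | (∃ h : Hist S A T, wealth r h = x) ∧ τ ≤ cdf P s0 r π x} q := by
  obtain ⟨h₀, hmax⟩ := Finite.exists_max (wealth r : Hist S A T → ℝ)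
  have hone : cdf P s0 r π (wealth r h₀) = 1 := by
    rw [← expCost_one (r := r) (s0 := s0) hP_sum hπ]
    exact Finset.sum_congr rfl fun h _ => by simp [hmax h]
  have hfin : {x | (∃ h : Hist S A T, wealth r h = x) ∧ τ ≤ cdf P s0 r π x}.Finite :=
    (Set.finite_range (wealth r : Hist S A T → ℝ)).subset fun x hx => hx.1
  obtain ⟨q, hq, hmin⟩ := Set.exists_min_image _ id hfin ⟨_, ⟨h₀, rfl⟩, hone ▸ hτ⟩
  exact ⟨q, hq, hmin⟩

end

/-- There exists a deterministic wealth-Markovian policy whose lower τ-quantile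
equals the maximum of the lower τ-quantiles over all randomized
history-dependent policies. -/
theorem stmt12 {S A : Type} [Fintype S] [DecidableEq S] [Nonempty S]
    [Fintype A] [DecidableEq A] [Nonempty A]
    (P : S → A → S → ℝ)
    (hP_nonneg : ∀ s a s', 0 ≤ P s a s')
    (hP_sum : ∀ s a, ∑ s', P s a s' = 1)
    (r : S → A → ℝ) (s0 : S) (T : ℕ) (hT : 1 ≤ T)
    (τ : ℝ) (hτ : τ ∈ Set.Ioc (0 : ℝ) 1) :
    ∃ (δ : Fin T → S → ℝ → A) (qδ : ℝ),
      IsLeast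
        {x | (∃ h : Hist S A T, wealth r h = x) ∧
          τ ≤ cdf P s0 r (wmPolicy r δ) x} qδ ∧
      ∀ π : Policy S A T, IsPolicy π →
        ∀ qπ : ℝ,
          IsLeast {x | (∃ h : Hist S A T, wealth r h = x) ∧ τ ≤ cdf P s0 r π x}
            qπ →
          qπ ≤ qδ := by
  choose q hq using fun δ : Fin T → S → ℝ → A =>
    exists_isLeast_quantile (r := r) (s0 := s0) hP_sum hτ.2 (isPolicy_wmPolicy (r := r) δ)
  have hfin : (Set.range q).Finite :=
    (Set.finite_range (wealth r : Hist S A T → ℝ)).subset <| by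
      rintro _ ⟨δ, rfl⟩
      exact (hq δ).1.1
  obtain ⟨_, ⟨δ, rfl⟩, hmax⟩ := Set.exists_max_image _ id hfin (Set.range_nonempty q)
  refine ⟨δ, q δ, hq δ, fun π hπ qπ hqπ => ?_⟩
  obtain ⟨ε, hε⟩ := exists_wmPolicy_expCost_le (r := r) (s0 := s0) (T := T) hP_nonneg
    fun _ w => if w < qπ then 1 else 0
  refine le_trans ?_ (hmax _ ⟨ε, rfl⟩)
  by_contra! hlt
  have h1 := (hq ε).1.2.trans
    (cdf_le_strictCdf hP_nonneg (isPolicy_wmPolicy (r := r) ε) hlt)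
  exact ((h1.trans (hε π hπ)).trans_lt (strictCdf_lt_of_isLeast hτ.1 hqπ)).false

end Stmt12
end

section
/- Consider a finite-horizon Markov decision process with finite state space S, finite nonempty action space A, transition function P : S × A → PMF(S), reward function r : S × A → ℝ, initial state s₀ ∈ S, and horizon T ≥ 1. A (randomized history-dependent) policy π assigns to each partial history (s₀, a₀, s₁, …, s_t) with t < T a probability distribution over A; it induces a probability distribution over T-histories h_T = (s₀, a₀, …, a_{T−1}, s_T) by sampling each a_t from π applied to the current partial history and each s_{t+1} from P(s_t, a_t). The wealth of a history is w(h_T) = Σ_{t=0}^{T−1} r(s_t, a_t). For τ ∈ [0,1), the upper τ-quantile of π is q̄_τ^π = max{x ∈ ℝ : x is a wealth value of some T-history and P_π[w(H_T) ≥ x] ≥ 1 − τ}. Then there exists a deterministic wealth-Markovian policy — i.e., a policy given by maps δ_t : S × ℝ → A for t = 1, …, T that select an action as a function only of the time step, the current state, and the sum of rewards accumulated so far — whose upper τ-quantile equals max over all randomized history-dependent policies π of q̄_τ^π. -/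
namespace Stmt13

/-- A `T`-history: a sequence of `T` actions together with the `T + 1` visited
states (`h.2 0` is the initial state). -/
abbrev Hist (S A : Type) (T : ℕ) := (Fin T → A) × (Fin (T + 1) → S)

/-- A randomized history-dependent policy: to each time step `t < T` and each
partial history `(s₀, a₀, s₁, …, s_t)` (given by the `t` actions and `t + 1`
states so far) it assigns a function `A → ℝ` (intended: a probability
distribution over actions). -/
abbrev Policy (S A : Type) (T : ℕ) :=
  (t : Fin T) → (Fin t → A) → (Fin (t + 1) → S) → A → ℝ

/-- The condition that `π` indeed assigns probability distributions over
actions. -/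
def IsPolicy {S A : Type} [Fintype A] {T : ℕ} (π : Policy S A T) : Prop :=
  (∀ t as ss a, 0 ≤ π t as ss a) ∧ (∀ t as ss, ∑ a, π t as ss a = 1)

/-- Probability that policy `π` generates the `T`-history `h` in the MDP with
transition function `P` and initial state `s0`: each action is sampled from `π`
applied to the current partial history and each next state from `P`. -/
def histProb {S A : Type} [DecidableEq S] {T : ℕ}
    (P : S → A → S → ℝ) (s0 : S) (π : Policy S A T) (h : Hist S A T) : ℝ :=
  (if h.2 0 = s0 then (1 : ℝ) else 0) *
    ∏ t : Fin T,
      π t (fun i => h.1 (Fin.castLE t.isLt.le i))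
          (fun i => h.2 (Fin.castLE (Nat.succ_le_succ t.isLt.le) i))
          (h.1 t) *
        P (h.2 t.castSucc) (h.1 t) (h.2 t.succ)

/-- The wealth of a `T`-history: the sum of the rewards received along it. -/
def wealth {S A : Type} {T : ℕ} (r : S → A → ℝ) (h : Hist S A T) : ℝ :=
  ∑ t : Fin T, r (h.2 t.castSucc) (h.1 t)

/-- `P_π[w(H_T) ≥ x]`: probability under policy `π` that the wealth of the
generated `T`-history is at least `x`. -/
noncomputable def dcdf {S A : Type} [Fintype S] [Fintype A] [DecidableEq S] {T : ℕ}
    (P : S → A → S → ℝ) (s0 : S) (r : S → A → ℝ) (π : Policy S A T) (x : ℝ) : ℝ :=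
  ∑ h : Hist S A T, if x ≤ wealth r h then histProb P s0 π h else 0

/-- The (deterministic) policy induced by a deterministic wealth-Markovian
decision rule `δ`: at time `t`, in current state `s` with accumulated wealth
`w`, play action `δ t s w` with probability one. -/
def wmPolicy {S A : Type} [DecidableEq A] {T : ℕ} (r : S → A → ℝ)
    (δ : Fin T → S → ℝ → A) : Policy S A T :=
  fun t as ss a =>
    if a = δ t (ss (Fin.last t)) (∑ i : Fin t, r (ss i.castSucc) (as i)) then 1
    else 0

/-- The policy on the first `T` steps obtained by forgetting the last decision. -/
def Policy.dropLast {S A : Type} {T : ℕ} (π : Policy S A (T + 1)) : Policy S A T :=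
  fun t as ss a => π t.castSucc as ss a

lemma IsPolicy.dropLast {S A : Type} [Fintype A] {T : ℕ} {π : Policy S A (T + 1)}
    (h : IsPolicy π) : IsPolicy (Policy.dropLast π) :=
  ⟨fun t as ss a => h.1 t.castSucc as ss a, fun t as ss => h.2 t.castSucc as ss⟩

lemma isPolicy_wmPolicy {S A : Type} [Fintype A] [DecidableEq A] {T : ℕ} (r : S → A → ℝ)
    (δ : Fin T → S → ℝ → A) : IsPolicy (wmPolicy r δ) := by
  constructor
  · intro t as ss a
    unfold wmPolicy
    split_ifs <;> norm_num
  · intro t as ss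
    simp [wmPolicy]

lemma dropLast_wmPolicy {S A : Type} [DecidableEq A] {T : ℕ} (r : S → A → ℝ)
    (δ : Fin (T + 1) → S → ℝ → A) :
    (wmPolicy r δ).dropLast = wmPolicy r fun t => δ t.castSucc := rfl

lemma sum_hist_succ {S A : Type} [Fintype S] [Fintype A] {T : ℕ}
    (F : Hist S A (T + 1) → ℝ) :
    ∑ h, F h = ∑ h : Hist S A T, ∑ a, ∑ s',
      F (Fin.snoc (α := fun _ => A) h.1 a, Fin.snoc (α := fun _ => S) h.2 s') := by
  rw [Fintype.sum_prod_type, ← (Fin.snocEquiv fun _ => A).sum_comp]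
  simp_rw [← (Fin.snocEquiv fun _ => S).sum_comp, Fintype.sum_prod_type]
  rw [Finset.sum_comm]
  refine Finset.sum_congr rfl fun as _ => ?_
  simp_rw [Finset.sum_comm (s := (Finset.univ : Finset S))]
  rw [Finset.sum_comm]
  rfl

lemma histProb_snoc {S A : Type} [DecidableEq S] {T : ℕ} (P : S → A → S → ℝ) (s0 : S)
    (π : Policy S A (T + 1)) (h : Hist S A T) (a : A) (s' : S) :
    histProb P s0 π (Fin.snoc (α := fun _ => A) h.1 a, Fin.snoc (α := fun _ => S) h.2 s') =
      histProb P s0 π.dropLast h * (π (Fin.last T) h.1 h.2 a * P (h.2 (Fin.last T)) a s') := by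
  have hA (t : ℕ) (ht : t ≤ T) (i : Fin t) :
      Fin.snoc (α := fun _ => A) h.1 a (Fin.castLE (ht.trans T.le_succ) i) =
        h.1 (Fin.castLE ht i) :=
    Fin.snoc_castSucc (α := fun _ => A) a h.1 (Fin.castLE ht i)
  have hS (t : ℕ) (ht : t ≤ T + 1) (i : Fin t) :
      Fin.snoc (α := fun _ => S) h.2 s' (Fin.castLE (ht.trans (T + 1).le_succ) i) =
        h.2 (Fin.castLE ht i) :=
    Fin.snoc_castSucc (α := fun _ => S) s' h.2 (Fin.castLE ht i)
  unfold histProb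
  rw [Fin.prod_univ_castSucc, ← mul_assoc]
  congr 1
  · congr 1
    refine Finset.prod_congr rfl fun t _ => ?_
    congr 1
    · simp only [Fin.snoc_castSucc]
      unfold Policy.dropLast
      congr 1
      · funext i
        exact hA t t.isLt.le i
      · funext i
        exact hS (t + 1) (Nat.succ_le_succ t.isLt.le) i
    · simp only [Fin.snoc_castSucc, Fin.succ_castSucc]
  · congr 1
    · simp only [Fin.snoc_last]
      congr 1
      · funext i
        exact hA T le_rfl i
      · funext i
        exact hS (T + 1) le_rfl i
    · simp only [Fin.snoc_castSucc, Fin.succ_last, Fin.snoc_last]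

lemma wealth_snoc {S A : Type} {T : ℕ} (r : S → A → ℝ) (h : Hist S A T) (a : A) (s' : S) :
    wealth r (Fin.snoc (α := fun _ => A) h.1 a, Fin.snoc (α := fun _ => S) h.2 s') =
      wealth r h + r (h.2 (Fin.last T)) a := by
  unfold wealth
  rw [Fin.sum_univ_castSucc]
  simp only [Fin.snoc_castSucc, Fin.snoc_last]

/-- Expectation under `π` of a terminal payoff depending on the final state and the wealth. -/
noncomputable def expect {S A : Type} [Fintype S] [Fintype A] [DecidableEq S] {T : ℕ}
    (P : S → A → S → ℝ) (s0 : S) (r : S → A → ℝ) (π : Policy S A T) (f : S → ℝ → ℝ) : ℝ :=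
  ∑ h : Hist S A T, histProb P s0 π h * f (h.2 (Fin.last T)) (wealth r h)

/-- The expected payoff of action `a` in state `s` at wealth `w`, one step before the end. -/
noncomputable def actionValue {S A : Type} [Fintype S] (P : S → A → S → ℝ) (r : S → A → ℝ)
    (f : S → ℝ → ℝ) (s : S) (w : ℝ) (a : A) : ℝ :=
  ∑ s', P s a s' * f s' (w + r s a)

lemma expect_succ {S A : Type} [Fintype S] [Fintype A] [DecidableEq S] {T : ℕ}
    (P : S → A → S → ℝ) (s0 : S) (r : S → A → ℝ) (π : Policy S A (T + 1)) (f : S → ℝ → ℝ) :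
    expect P s0 r π f = ∑ h : Hist S A T, histProb P s0 π.dropLast h *
      ∑ a, π (Fin.last T) h.1 h.2 a *
        actionValue P r f (h.2 (Fin.last T)) (wealth r h) a := by
  unfold expect actionValue
  rw [sum_hist_succ]
  simp only [histProb_snoc, wealth_snoc, Fin.snoc_last, Finset.mul_sum, mul_assoc]

lemma histProb_nonneg {S A : Type} [Fintype A] [DecidableEq S] {T : ℕ}
    {P : S → A → S → ℝ} (hP : ∀ s a s', 0 ≤ P s a s') (s0 : S) {π : Policy S A T}
    (hπ : IsPolicy π) (h : Hist S A T) : 0 ≤ histProb P s0 π h := by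
  unfold histProb
  refine mul_nonneg (by split_ifs <;> norm_num) (Finset.prod_nonneg fun t _ => ?_)
  exact mul_nonneg (hπ.1 _ _ _ _) (hP _ _ _)

lemma sum_histProb {S A : Type} [Fintype S] [Fintype A] [DecidableEq S]
    {P : S → A → S → ℝ} (hP : ∀ s a, ∑ s', P s a s' = 1) (s0 : S) {T : ℕ} {π : Policy S A T}
    (hπ : IsPolicy π) : ∑ h, histProb P s0 π h = 1 := by
  induction T with
  | zero =>
    rw [Fintype.sum_prod_type, Fintype.sum_unique,
      ← (Equiv.funUnique (Fin 1) S).symm.sum_comp]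
    simp [histProb]
  | succ T ih =>
    rw [sum_hist_succ, ← ih hπ.dropLast]
    refine Finset.sum_congr rfl fun h _ => ?_
    simp only [histProb_snoc, ← Finset.mul_sum, hP, mul_one]
    rw [hπ.2 (Fin.last T) h.1 h.2, mul_one]

/-- Bellman's principle: some deterministic wealth-Markovian policy maximizes the expectation of a
terminal payoff depending on the final state and the wealth. -/
lemma exists_wmPolicy_expect_ge {S A : Type} [Fintype S] [DecidableEq S]
    [Fintype A] [DecidableEq A] [Nonempty A] {P : S → A → S → ℝ}
    (hP : ∀ s a s', 0 ≤ P s a s') (r : S → A → ℝ) (s0 : S) (T : ℕ) (f : S → ℝ → ℝ) :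
    ∃ δ : Fin T → S → ℝ → A, ∀ π : Policy S A T, IsPolicy π →
      expect P s0 r π f ≤ expect P s0 r (wmPolicy r δ) f := by
  induction T generalizing f with
  | zero =>
    refine ⟨fun t => t.elim0, fun π _ => le_of_eq ?_⟩
    simp [expect, histProb]
  | succ T ih =>
    choose b hb using fun s w => Finite.exists_max (actionValue P r f s w)
    obtain ⟨δ, hδ⟩ := ih fun s w => actionValue P r f s w (b s w)
    refine ⟨Fin.snoc (α := fun _ => S → ℝ → A) δ b, fun π hπ => ?_⟩
    have key : expect P s0 r (wmPolicy r (Fin.snoc (α := fun _ => S → ℝ → A) δ b)) f =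
        expect P s0 r (wmPolicy r δ) fun s w => actionValue P r f s w (b s w) := by
      rw [expect_succ, dropLast_wmPolicy]
      simp only [Fin.snoc_castSucc]
      refine Finset.sum_congr rfl fun h _ => ?_
      congr 1
      simp only [wmPolicy, Fin.snoc_last, ite_mul, one_mul, zero_mul]
      exact Fintype.sum_ite_eq' _ _
    rw [key]
    refine le_trans ?_ (hδ π.dropLast hπ.dropLast)
    rw [expect_succ]
    refine Finset.sum_le_sum fun h _ =>
      mul_le_mul_of_nonneg_left ?_ (histProb_nonneg hP s0 hπ.dropLast h)
    calc _ ≤ ∑ a, π (Fin.last T) h.1 h.2 a * actionValue P r f (h.2 (Fin.last T)) (wealth r h)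
            (b (h.2 (Fin.last T)) (wealth r h)) :=
          Finset.sum_le_sum fun a _ =>
            mul_le_mul_of_nonneg_left (hb _ _ a) (hπ.1 (Fin.last T) h.1 h.2 a)
      _ = _ := by
          rw [← Finset.sum_mul, hπ.2 (Fin.last T) h.1 h.2, one_mul]

lemma dcdf_eq_expect {S A : Type} [Fintype S] [Fintype A] [DecidableEq S] {T : ℕ}
    (P : S → A → S → ℝ) (s0 : S) (r : S → A → ℝ) (π : Policy S A T) (x : ℝ) :
    dcdf P s0 r π x = expect P s0 r π fun _ w => if x ≤ w then 1 else 0 := by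
  simp [dcdf, expect]

/-- There exists a deterministic wealth-Markovian policy whose upper τ-quantile
equals the maximum of the upper τ-quantiles over all randomized
history-dependent policies. -/
theorem stmt13 {S A : Type} [Fintype S] [DecidableEq S] [Nonempty S]
    [Fintype A] [DecidableEq A] [Nonempty A]
    (P : S → A → S → ℝ)
    (hP_nonneg : ∀ s a s', 0 ≤ P s a s')
    (hP_sum : ∀ s a, ∑ s', P s a s' = 1)
    (r : S → A → ℝ) (s0 : S) (T : ℕ) (hT : 1 ≤ T)
    (τ : ℝ) (hτ : τ ∈ Set.Ico (0 : ℝ) 1) :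
    ∃ (δ : Fin T → S → ℝ → A) (qδ : ℝ),
      IsGreatest
        {x | (∃ h : Hist S A T, wealth r h = x) ∧
          1 - τ ≤ dcdf P s0 r (wmPolicy r δ) x} qδ ∧
      ∀ π : Policy S A T, IsPolicy π →
        ∀ qπ : ℝ,
          IsGreatest
            {x | (∃ h : Hist S A T, wealth r h = x) ∧ 1 - τ ≤ dcdf P s0 r π x}
            qπ →
          qπ ≤ qδ := by
  choose δ hδ using fun x : ℝ =>
    exists_wmPolicy_expect_ge hP_nonneg r s0 T fun _ w => if x ≤ w then 1 else 0
  simp only [← dcdf_eq_expect] at hδ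
  let X : Set ℝ := {x | (∃ h : Hist S A T, wealth r h = x) ∧
    1 - τ ≤ dcdf P s0 r (wmPolicy r (δ x)) x}
  have hfin : X.Finite :=
    (Set.finite_range (wealth r : Hist S A T → ℝ)).subset fun x hx => hx.1
  have hne : X.Nonempty := by
    obtain ⟨h₀, hh₀⟩ := Finite.exists_min (wealth r : Hist S A T → ℝ)
    refine ⟨wealth r h₀, ⟨h₀, rfl⟩, ?_⟩
    simp only [dcdf, hh₀, if_true]
    rw [sum_histProb hP_sum s0 (isPolicy_wmPolicy r _)]
    linarith [hτ.1]
  obtain ⟨q, hqX, hq⟩ := Set.exists_max_image X id hfin hne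
  have hub (π : Policy S A T) (hπ : IsPolicy π) (x : ℝ) (hx : ∃ h : Hist S A T, wealth r h = x)
      (hle : 1 - τ ≤ dcdf P s0 r π x) : x ≤ q :=
    hq x ⟨hx, hle.trans (hδ x π hπ)⟩
  exact ⟨δ q, q, ⟨hqX, fun x hx => hub _ (isPolicy_wmPolicy r _) x hx.1 hx.2⟩,
    fun π hπ x hx => hub π hπ x hx.1.1 hx.1.2⟩

end Stmt13
end

section
/- Consider a finite-horizon Markov decision process with finite state space S, finite nonempty action space A, transition function P : S × A → PMF(S), reward function r : S × A → ℝ, initial state s₀ ∈ S, and horizon T ≥ 1, and fix a target x ∈ ℝ. Define value functions V_t : S × ℝ → ℝ by V_{T+1}(s, w) = 1 if w > x and 0 otherwise, and for t = T down to 1, V_t(s, w) = max_{a ∈ A} Σ_{s' ∈ S} P(s, a)(s') · V_{t+1}(s', w + r(s, a)). Then V_1(s₀, 0) equals the maximum, over all randomized history-dependent policies π, of the probability under π that the total wealth w(H_T) = Σ_{t=0}^{T−1} r(s_t, a_t) of the generated T-history strictly exceeds x; moreover this maximum is attained. -/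
namespace Stmt14

/-- A `T`-history: a sequence of `T` actions together with the `T + 1` visited
states (`h.2 0` is the initial state). -/
abbrev Hist (S A : Type) (T : ℕ) := (Fin T → A) × (Fin (T + 1) → S)

/-- A randomized history-dependent policy: to each time step `t < T` and each
partial history `(s₀, a₀, s₁, …, s_t)` (given by the `t` actions and `t + 1`
states so far) it assigns a function `A → ℝ` (intended: a probability
distribution over actions). -/
abbrev Policy (S A : Type) (T : ℕ) :=
  (t : Fin T) → (Fin t → A) → (Fin (t + 1) → S) → A → ℝ

/-- The condition that `π` indeed assigns probability distributions over
actions. -/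
def IsPolicy {S A : Type} [Fintype A] {T : ℕ} (π : Policy S A T) : Prop :=
  (∀ t as ss a, 0 ≤ π t as ss a) ∧ (∀ t as ss, ∑ a, π t as ss a = 1)

/-- Probability that policy `π` generates the `T`-history `h` in the MDP with
transition function `P` and initial state `s0`: each action is sampled from `π`
applied to the current partial history and each next state from `P`. -/
def histProb {S A : Type} [DecidableEq S] {T : ℕ}
    (P : S → A → S → ℝ) (s0 : S) (π : Policy S A T) (h : Hist S A T) : ℝ :=
  (if h.2 0 = s0 then (1 : ℝ) else 0) *
    ∏ t : Fin T,
      π t (fun i => h.1 (Fin.castLE t.isLt.le i))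
          (fun i => h.2 (Fin.castLE (Nat.succ_le_succ t.isLt.le) i))
          (h.1 t) *
        P (h.2 t.castSucc) (h.1 t) (h.2 t.succ)

/-- The wealth of a `T`-history: the sum of the rewards received along it. -/
def wealth {S A : Type} {T : ℕ} (r : S → A → ℝ) (h : Hist S A T) : ℝ :=
  ∑ t : Fin T, r (h.2 t.castSucc) (h.1 t)

/-- Functional backward induction with target `x`, indexed by the number `k` of
remaining time steps: `valIter P r x 0 s w = U_x(w)` (the target utility, `1`
iff `w > x`), and
`valIter P r x (k+1) s w = max_a Σ_{s'} P s a s' * valIter P r x k s' (w + r s a)`.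
Thus `V_t(s, w) = valIter P r x (T + 1 - t) s w`, so that
`V_{T+1}(s, w) = U_x(w)` and `V_1(s, w) = valIter P r x T s w`. -/
noncomputable def valIter {S A : Type} [Fintype S] [Fintype A] [Nonempty A]
    (P : S → A → S → ℝ) (r : S → A → ℝ) (x : ℝ) : ℕ → S → ℝ → ℝ
  | 0 => fun _ w => if x < w then 1 else 0
  | k + 1 => fun s w =>
      Finset.univ.sup' Finset.univ_nonempty
        (fun a => ∑ s', P s a s' * valIter P r x k s' (w + r s a))

/-- Summing over `(T + 1)`-histories amounts to summing over `T`-histories and their one-step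
extensions. -/
theorem sum_hist_succ {S A : Type} [Fintype S] [Fintype A] {T : ℕ}
    (f : Hist S A (T + 1) → ℝ) :
    ∑ h, f h = ∑ h : Hist S A T, ∑ a, ∑ s,
      f ((Fin.snoc h.1 a : Fin (T + 1) → A), (Fin.snoc h.2 s : Fin (T + 2) → S)) := by
  let e : (Hist S A T × A × S) ≃ Hist S A (T + 1) :=
    { toFun := fun p => ((Fin.snoc p.1.1 p.2.1 : Fin (T + 1) → A),
        (Fin.snoc p.1.2 p.2.2 : Fin (T + 2) → S))
      invFun := fun h => ((fun i => h.1 i.castSucc, fun i => h.2 i.castSucc),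
        h.1 (Fin.last T), h.2 (Fin.last (T + 1)))
      left_inv := fun p => by simp
      right_inv := fun h => Prod.ext (Fin.snoc_init_self h.1) (Fin.snoc_init_self h.2) }
  rw [← e.sum_comp, Fintype.sum_prod_type]
  simp_rw [Fintype.sum_prod_type]
  rfl

theorem wealth_snoc {S A : Type} {T : ℕ} (r : S → A → ℝ) (h : Hist S A T) (a : A) (s : S) :
    wealth r ((Fin.snoc h.1 a : Fin (T + 1) → A), (Fin.snoc h.2 s : Fin (T + 2) → S)) =
      wealth r h + r (h.2 (Fin.last T)) a := by
  simp [wealth, Fin.sum_univ_castSucc]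

/-- The restriction of a policy to all but the last time step. -/
def Policy.init {S A : Type} {T : ℕ} (π : Policy S A (T + 1)) : Policy S A T :=
  fun t => π t.castSucc

theorem IsPolicy.init {S A : Type} [Fintype A] {T : ℕ} {π : Policy S A (T + 1)}
    (hπ : IsPolicy π) : IsPolicy π.init :=
  ⟨fun t => hπ.1 t.castSucc, fun t => hπ.2 t.castSucc⟩

theorem histProb_snoc {S A : Type} [DecidableEq S] {T : ℕ} (P : S → A → S → ℝ) (s0 : S)
    (π : Policy S A (T + 1)) (h : Hist S A T) (a : A) (s : S) :
    histProb P s0 π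
        ((Fin.snoc h.1 a : Fin (T + 1) → A), (Fin.snoc h.2 s : Fin (T + 2) → S)) =
      histProb P s0 π.init h *
        (π (Fin.last T) h.1 h.2 a * P (h.2 (Fin.last T)) a s) := by
  have snoc_castLE : ∀ {X : Type} {n m : ℕ} (f : Fin n → X) (y : X) (hm : m ≤ n)
      (hm' : m ≤ n + 1), (fun i : Fin m => (Fin.snoc f y : Fin (n + 1) → X) (Fin.castLE hm' i)) =
        fun i => f (Fin.castLE hm i) := by
    intro X n m f y hm hm'
    funext i
    exact Fin.snoc_castSucc (α := fun _ => X) y f (Fin.castLE hm i)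
  have h0 : (Fin.snoc h.2 s : Fin (T + 2) → S) 0 = h.2 0 :=
    Fin.snoc_castSucc (α := fun _ => S) s h.2 0
  unfold histProb
  rw [Fin.prod_univ_castSucc, ← mul_assoc]
  simp only [h0]
  congr 1
  · congr 1
    refine Finset.prod_congr rfl fun t _ => ?_
    exact congrArg₂ (· * ·)
      (congr (congr (congrArg (π t.castSucc) (snoc_castLE h.1 a t.isLt.le _))
        (snoc_castLE h.2 s (Nat.succ_le_succ t.isLt.le) _)) (Fin.snoc_castSucc ..))
      (by simp only [Fin.succ_castSucc, Fin.snoc_castSucc])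
  · exact congrArg₂ (· * ·)
      (congr (congr (congrArg (π (Fin.last T)) (snoc_castLE h.1 a le_rfl _))
        (snoc_castLE h.2 s le_rfl _)) (Fin.snoc_last ..))
      (by simp only [Fin.succ_last, Fin.snoc_castSucc, Fin.snoc_last])

theorem histProb_nonneg {S A : Type} [DecidableEq S] [Fintype A] {T : ℕ} {P : S → A → S → ℝ}
    (hP : ∀ s a s', 0 ≤ P s a s') (s0 : S) {π : Policy S A T} (hπ : IsPolicy π)
    (h : Hist S A T) : 0 ≤ histProb P s0 π h :=
  mul_nonneg (by split_ifs <;> norm_num)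
    (Finset.prod_nonneg fun t _ => mul_nonneg (hπ.1 t _ _ _) (hP _ _ _))

/-- The expectation, under the policy `π`, of the utility `U` of the final state and wealth. -/
noncomputable def expUtility {S A : Type} [Fintype S] [DecidableEq S] [Fintype A] {T : ℕ}
    (P : S → A → S → ℝ) (r : S → A → ℝ) (s0 : S) (π : Policy S A T) (U : S → ℝ → ℝ) : ℝ :=
  ∑ h, histProb P s0 π h * U (h.2 (Fin.last T)) (wealth r h)

theorem expUtility_zero {S A : Type} [Fintype S] [DecidableEq S] [Fintype A]
    (P : S → A → S → ℝ) (r : S → A → ℝ) (s0 : S) (π : Policy S A 0) (U : S → ℝ → ℝ) :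
    expUtility P r s0 π U = U s0 0 := by
  unfold expUtility
  rw [Fintype.sum_eq_single (default, fun _ => s0)]
  · simp [histProb, wealth]
  · intro h hne
    have : h.2 0 ≠ s0 := fun h0 => hne <| Prod.ext (Subsingleton.elim _ _) <| by
      funext i
      rw [Fin.fin_one_eq_zero i, h0]
    simp [histProb, this]

theorem expUtility_succ {S A : Type} [Fintype S] [DecidableEq S] [Fintype A] {T : ℕ}
    (P : S → A → S → ℝ) (r : S → A → ℝ) (s0 : S) (π : Policy S A (T + 1)) (U : S → ℝ → ℝ) :
    expUtility P r s0 π U =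
      ∑ h : Hist S A T, histProb P s0 π.init h *
        ∑ a, π (Fin.last T) h.1 h.2 a *
          ∑ s', P (h.2 (Fin.last T)) a s' * U s' (wealth r h + r (h.2 (Fin.last T)) a) := by
  unfold expUtility
  rw [sum_hist_succ]
  refine Finset.sum_congr rfl fun h _ => ?_
  rw [Finset.mul_sum]
  refine Finset.sum_congr rfl fun a _ => ?_
  rw [Finset.mul_sum, Finset.mul_sum]
  refine Finset.sum_congr rfl fun s _ => ?_
  simp only [histProb_snoc, wealth_snoc, Fin.snoc_last]
  ring

theorem expUtility_le_valIter {S A : Type} [Fintype S] [DecidableEq S] [Fintype A] [Nonempty A]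
    {P : S → A → S → ℝ} (hP : ∀ s a s', 0 ≤ P s a s') (r : S → A → ℝ) (s0 : S) (x : ℝ) {T : ℕ}
    {π : Policy S A T} (hπ : IsPolicy π) (k : ℕ) :
    expUtility P r s0 π (valIter P r x k) ≤ valIter P r x (T + k) s0 0 := by
  induction T generalizing k with
  | zero => rw [expUtility_zero, Nat.zero_add]
  | succ T ih =>
    rw [Nat.succ_add_eq_add_succ]
    refine le_trans ?_ (ih hπ.init (k + 1))
    rw [expUtility_succ]
    refine Finset.sum_le_sum fun h _ =>
      mul_le_mul_of_nonneg_left ?_ (histProb_nonneg hP s0 hπ.init h)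
    calc _ ≤ ∑ a, π (Fin.last T) h.1 h.2 a *
            valIter P r x (k + 1) (h.2 (Fin.last T)) (wealth r h) :=
          Finset.sum_le_sum fun a _ => mul_le_mul_of_nonneg_left
            (Finset.le_sup' (fun a => ∑ s', P (h.2 (Fin.last T)) a s' *
              valIter P r x k s' (wealth r h + r (h.2 (Fin.last T)) a)) (Finset.mem_univ a))
            (hπ.1 _ _ _ _)
      _ = _ := by rw [← Finset.sum_mul, hπ.2, one_mul]

/-- Some action attains the maximum in each step of the backward induction. -/
theorem exists_valIter_succ_eq {S A : Type} [Fintype S] [Fintype A] [Nonempty A]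
    (P : S → A → S → ℝ) (r : S → A → ℝ) (x : ℝ) (k : ℕ) (s : S) (w : ℝ) :
    ∃ a, valIter P r x (k + 1) s w = ∑ s', P s a s' * valIter P r x k s' (w + r s a) :=
  let ⟨a, _, ha⟩ := Finset.exists_mem_eq_sup' Finset.univ_nonempty
    (fun a => ∑ s', P s a s' * valIter P r x k s' (w + r s a))
  ⟨a, ha⟩

/-- The policy playing deterministically the action `g k s w`, where `s` is the current state, `w`
the wealth accumulated so far and `k + 1` the number of steps that remain out of `N`. -/
def markovPolicy {S A : Type} [DecidableEq A] (r : S → A → ℝ) (g : ℕ → S → ℝ → A) (N T : ℕ) :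
    Policy S A T :=
  fun t as ss => Pi.single (g (N - (t + 1)) (ss (Fin.last t)) (wealth r (as, ss))) 1

theorem isPolicy_markovPolicy {S A : Type} [Fintype A] [DecidableEq A] (r : S → A → ℝ)
    (g : ℕ → S → ℝ → A) (N T : ℕ) : IsPolicy (markovPolicy r g N T) := by
  refine ⟨fun t as ss a => ?_, fun t as ss => ?_⟩
  · exact (Pi.single_nonneg.2 zero_le_one : (0 : A → ℝ) ≤ _) a
  · simp [markovPolicy]

theorem expUtility_markovPolicy {S A : Type} [Fintype S] [DecidableEq S] [Fintype A]
    [DecidableEq A] [Nonempty A] {P : S → A → S → ℝ} {r : S → A → ℝ} {x : ℝ}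
    {g : ℕ → S → ℝ → A} (hg : ∀ k s w, valIter P r x (k + 1) s w =
      ∑ s', P s (g k s w) s' * valIter P r x k s' (w + r s (g k s w)))
    (s0 : S) (T k : ℕ) :
    expUtility P r s0 (markovPolicy r g (T + k) T) (valIter P r x k) =
      valIter P r x (T + k) s0 0 := by
  induction T generalizing k with
  | zero => rw [expUtility_zero, Nat.zero_add]
  | succ T ih =>
    rw [Nat.succ_add_eq_add_succ, ← ih (k + 1), expUtility_succ]
    refine Finset.sum_congr rfl fun h _ => congrArg₂ _ rfl ?_
    have hk : T + k.succ - (((Fin.last T : Fin (T + 1)) : ℕ) + 1) = k := by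
      rw [Fin.val_last]; omega
    simp only [markovPolicy, hk, Pi.single_apply, ite_mul, one_mul, zero_mul,
      Finset.sum_ite_eq', Finset.mem_univ, if_true]
    exact (hg k _ _).symm

/-- Correctness of functional backward induction: `V_1(s₀, 0)` is the maximal
probability, over all randomized history-dependent policies, that the total
wealth of the generated `T`-history strictly exceeds the target `x`; moreover
the maximum is attained by some policy. -/
theorem stmt14 {S A : Type} [Fintype S] [DecidableEq S] [Nonempty S]
    [Fintype A] [DecidableEq A] [Nonempty A]
    (P : S → A → S → ℝ)
    (hP_nonneg : ∀ s a s', 0 ≤ P s a s')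
    (hP_sum : ∀ s a, ∑ s', P s a s' = 1)
    (r : S → A → ℝ) (s0 : S) (T : ℕ) (hT : 1 ≤ T) (x : ℝ) :
    IsGreatest
      {pr : ℝ | ∃ π : Policy S A T, IsPolicy π ∧
        pr = ∑ h : Hist S A T,
          if x < wealth r h then histProb P s0 π h else 0}
      (valIter P r x T s0 0) := by
  have key (π : Policy S A T) :
      (∑ h : Hist S A T, if x < wealth r h then histProb P s0 π h else 0) =
        expUtility P r s0 π (valIter P r x 0) := by
    simp [expUtility, valIter]
  constructor
  · choose g hg using exists_valIter_succ_eq P r x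
    exact ⟨markovPolicy r g T T, isPolicy_markovPolicy r g T T,
      (key _).symm ▸ (expUtility_markovPolicy hg s0 T 0).symm⟩
  · rintro _ ⟨π, hπ, rfl⟩
    rw [key]
    exact expUtility_le_valIter hP_nonneg r s0 x hπ 0

end Stmt14
end
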